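/- The one-way atomic decomposition does not preserve termination nor sometimes-termination of the restricted chase or the Datalog-first restricted chase: there exists a rule set 𝓡 belonging to all four classes CT_R^∀, CT_{df-R}^∀, CT_{df-R}^∃ and CT_R^∃ such that 1ad(𝓡) belongs to none of them; in particular 𝓡 = {P(x,y) → ∃z.(P(y,z) ∧ P(z,y))} is such a rule set. -/

import Mathlib

namespace ExRules

open scoped Classical

noncomputable section

/-- Terms: constants or variables, each indexed by a natural number. -/
inductive Term where
  | const : ℕ → Term
  | var : ℕ → Term
deriving DecidableEq

/-- An atom: a predicate symbol applied to a list of terms (the arity of the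
predicate is the length of the argument list). -/
structure Atom where
  pred : ℕ
  args : List Term
deriving DecidableEq

/-- A factbase is a finite set of atoms. -/
abbrev FactBase := Finset Atom

/-- A substitution: a map on variables (extended by the identity on constants). -/
abbrev Subst := ℕ → Term

def applyTerm (σ : Subst) : Term → Term
  | .const c => .const c
  | .var v => σ v

def Atom.subst (σ : Subst) (a : Atom) : Atom := ⟨a.pred, a.args.map (applyTerm σ)⟩

def Term.vars : Term → Finset ℕ
  | .const _ => ∅
  | .var v => {v}

def Atom.vars (a : Atom) : Finset ℕ := a.args.foldr (fun t s => t.vars ∪ s) ∅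

def FactBase.vars (F : FactBase) : Finset ℕ := F.sup Atom.vars

/-- The variables occurring in a (possibly infinite) set of atoms. -/
def setVars (S : Set Atom) : Set ℕ := {v | ∃ a ∈ S, v ∈ a.vars}

/-- `σ` is a homomorphism from the atom set `S` to the atom set `S'`. -/
def IsHom (σ : Subst) (S S' : Set Atom) : Prop := ∀ a ∈ S, a.subst σ ∈ S'

/-- A retraction is a homomorphism that is the identity on the common variables. -/
def IsRetraction (σ : Subst) (S S' : Set Atom) : Prop :=
  IsHom σ S S' ∧ ∀ v, v ∈ setVars S → v ∈ setVars S' → σ v = Term.var v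

/-- An existential rule `B → ∃z.H` with nonempty body and head.  The frontier and
the existential variables are determined by the variables shared between body and
head. -/
structure Rule where
  body : Finset Atom
  head : Finset Atom
  body_nonempty : body.Nonempty
  head_nonempty : head.Nonempty

instance : DecidableEq Rule := fun R S =>
  decidable_of_iff (R.body = S.body ∧ R.head = S.head) (by
    constructor
    · rintro ⟨h1, h2⟩
      cases R; cases S; simp_all
    · rintro rfl; exact ⟨rfl, rfl⟩)

/-- The frontier of a rule: the variables shared by body and head. -/
def Rule.frontier (R : Rule) : Finset ℕ := FactBase.vars R.body ∩ FactBase.vars R.head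

/-- The existential variables of a rule: head variables not occurring in the body. -/
def Rule.exVars (R : Rule) : Finset ℕ := FactBase.vars R.head \ FactBase.vars R.body

/-- A rule is Datalog if it has no existential variable. -/
def Rule.IsDatalog (R : Rule) : Prop := R.exVars = ∅

/-- A rule has an atomic head if its head is a single atom. -/
def Rule.IsAtomicHead (R : Rule) : Prop := R.head.card = 1

/-- A rule set is a finite set of existential rules. -/
abbrev RuleSet := Finset Rule

instance : Encodable Term :=
  Encodable.ofEquiv (ℕ ⊕ ℕ)
    { toFun := fun t => match t with | .const c => .inl c | .var v => .inr v
      invFun := fun s => match s with | .inl c => .const c | .inr v => .var v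
      left_inv := by intro t; cases t <;> rfl
      right_inv := by intro s; cases s <;> rfl }

instance : Encodable Atom :=
  Encodable.ofEquiv (ℕ × List Term)
    { toFun := fun a => (a.pred, a.args)
      invFun := fun p => ⟨p.1, p.2⟩
      left_inv := fun _ => rfl
      right_inv := fun _ => rfl }

instance : Encodable Rule :=
  Encodable.ofEquiv {p : Finset Atom × Finset Atom // p.1.Nonempty ∧ p.2.Nonempty}
    { toFun := fun R => ⟨(R.body, R.head), R.body_nonempty, R.head_nonempty⟩
      invFun := fun p => ⟨p.1.1, p.1.2, p.2.1, p.2.2⟩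
      left_inv := fun _ => rfl
      right_inv := fun _ => rfl }

/-- A trigger `(R, π)`: a rule together with a substitution. -/
structure Trigger where
  rule : Rule
  map : Subst

/-- The canonical fresh variable `z_t` associated to a trigger `t` and an
existential variable `z`: it is unique for `z` and (the relevant part of) `t`. -/
def Trigger.freshVar (t : Trigger) (z : ℕ) : ℕ :=
  Nat.pair
    (Encodable.encode (t.rule, ((FactBase.vars t.rule.body).sort (· ≤ ·)).map t.map)) z

/-- The extension `π_R` of the substitution of a trigger, mapping each existential
variable `z` to the fresh variable `z_t`. -/
def Trigger.ext (t : Trigger) : Subst := fun v =>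
  if v ∈ t.rule.exVars then Term.var (t.freshVar v) else t.map v

/-- The output of a trigger: `out(t) = π_R(H)`. -/
def Trigger.out (t : Trigger) : Finset Atom := t.rule.head.image (Atom.subst t.ext)

/-- `t` is a trigger on the factbase `F`: its substitution is a homomorphism from
the body of its rule to `F`. -/
def Trigger.IsOn (t : Trigger) (F : FactBase) : Prop := IsHom t.map ↑t.rule.body ↑F

/-- The chase variants: oblivious, semi-oblivious, restricted, equivalent. -/
inductive Variant where
  | O | SO | R | E

/-- Applicability of a trigger on a factbase, for each chase variant. -/
def Applicable : Variant → Trigger → FactBase → Prop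
  | .O, t, F => ¬ t.out ⊆ F
  | .SO, t, F => ∀ t' : Trigger, t'.rule = t.rule →
      (∀ v ∈ t.rule.frontier, t'.map v = t.map v) → ¬ t'.out ⊆ F
  | .R, t, F => ¬ ∃ σ : Subst, IsRetraction σ ↑(F ∪ t.out) ↑F
  | .E, t, F => ¬ ∃ σ : Subst, IsHom σ ↑(F ∪ t.out) ↑F

/-- An atom set `M` satisfies a rule `B → ∃z.H` if every homomorphism from `B`
to `M` extends to a homomorphism mapping `H` into `M`. -/
def SatisfiesRule (M : Set Atom) (R : Rule) : Prop :=
  ∀ σ : Subst, IsHom σ ↑R.body M →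
    ∃ σ' : Subst, (∀ v ∈ FactBase.vars R.body, σ' v = σ v) ∧ IsHom σ' ↑R.head M

/-- A (finite or infinite) derivation from the knowledge base `⟨𝓡, F⟩`:
`len` is the number of triggers (possibly `⊤`), `fb i` is the `i`-th factbase and,
for `i < len`, `tr i` is the trigger producing `fb (i+1)` from `fb i`. -/
structure Derivation (𝓡 : RuleSet) (F : FactBase) where
  len : ℕ∞
  fb : ℕ → FactBase
  tr : ℕ → Trigger
  fb_zero : fb 0 = F
  rule_mem : ∀ i : ℕ, (i : ℕ∞) < len → (tr i).rule ∈ 𝓡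
  trig_on : ∀ i : ℕ, (i : ℕ∞) < len → (tr i).IsOn (fb i)
  trig_new : ∀ i : ℕ, (i : ℕ∞) < len → ¬ (tr i).out ⊆ fb i
  fb_succ : ∀ i : ℕ, (i : ℕ∞) < len → fb (i + 1) = fb i ∪ (tr i).out
  fb_stall : ∀ i : ℕ, ¬ (i : ℕ∞) < len → fb (i + 1) = fb i

namespace Derivation

variable {𝓡 : RuleSet} {F : FactBase}

/-- An `X`-derivation: every applied trigger is `X`-applicable when applied. -/
def IsX (X : Variant) (D : Derivation 𝓡 F) : Prop :=
  ∀ i : ℕ, (i : ℕ∞) < D.len → Applicable X (D.tr i) (D.fb i)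

/-- Datalog-first: a non-Datalog rule is only applied when all Datalog rules of
the rule set are satisfied. -/
def DatalogFirst (D : Derivation 𝓡 F) : Prop :=
  ∀ i : ℕ, (i : ℕ∞) < D.len → ¬ (D.tr i).rule.IsDatalog →
    ∀ R ∈ 𝓡, R.IsDatalog → SatisfiesRule ↑(D.fb i) R

/-- Fairness: every trigger `X`-applicable on some factbase of the derivation is
eventually not `X`-applicable. -/
def Fair (X : Variant) (D : Derivation 𝓡 F) : Prop :=
  ∀ i : ℕ, (i : ℕ∞) ≤ D.len → ∀ t : Trigger, t.rule ∈ 𝓡 → t.IsOn (D.fb i) →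
    Applicable X t (D.fb i) →
    ∃ j : ℕ, i < j ∧ (j : ℕ∞) ≤ D.len ∧ ¬ Applicable X t (D.fb j)

/-- A derivation is finite if its length is not `⊤`. -/
def Finite (D : Derivation 𝓡 F) : Prop := D.len ≠ ⊤

end Derivation

/-- `CT_X^∀` (non-Datalog-first): every fair `X`-derivation from every KB is finite. -/
def CTall (X : Variant) (𝓡 : RuleSet) : Prop :=
  ∀ F : FactBase, ∀ D : Derivation 𝓡 F, D.IsX X → D.Fair X → D.Finite

/-- `CT_X^∃`: some fair `X`-derivation from every KB is finite. -/
def CTex (X : Variant) (𝓡 : RuleSet) : Prop :=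
  ∀ F : FactBase, ∃ D : Derivation 𝓡 F, D.IsX X ∧ D.Fair X ∧ D.Finite

/-- `CT_{df-X}^∀`: every fair Datalog-first `X`-derivation from every KB is finite. -/
def CTallDF (X : Variant) (𝓡 : RuleSet) : Prop :=
  ∀ F : FactBase, ∀ D : Derivation 𝓡 F, D.IsX X → D.DatalogFirst → D.Fair X → D.Finite

/-- `CT_{df-X}^∃`: some fair Datalog-first `X`-derivation from every KB is finite. -/
def CTexDF (X : Variant) (𝓡 : RuleSet) : Prop :=
  ∀ F : FactBase, ∃ D : Derivation 𝓡 F, D.IsX X ∧ D.DatalogFirst ∧ D.Fair X ∧ D.Finite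

/-! ### Single-piece decomposition -/

/-- Adjacency in the piece graph of a rule: two head atoms sharing an existential
variable. -/
def PieceAdj (R : Rule) (a b : Atom) : Prop :=
  a ∈ R.head ∧ b ∈ R.head ∧ (a.vars ∩ b.vars ∩ R.exVars).Nonempty

/-- The piece (connected component of the piece graph) containing a given head atom. -/
def pieceOf (R : Rule) (a : Atom) : Finset Atom :=
  R.head.filter fun b => Relation.ReflTransGen (PieceAdj R) a b

theorem self_mem_pieceOf {R : Rule} {a : Atom} (h : a ∈ R.head) : a ∈ pieceOf R a := by
  rw [pieceOf, Finset.mem_filter]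
  exact ⟨h, Relation.ReflTransGen.refl⟩

/-- The single-piece decomposition of a rule. -/
def Rule.sp (R : Rule) : Finset Rule :=
  R.head.attach.image fun a =>
    ⟨R.body, pieceOf R a.1, R.body_nonempty, ⟨a.1, self_mem_pieceOf a.2⟩⟩

/-- The single-piece decomposition of a rule set. -/
def spSet (𝓡 : RuleSet) : RuleSet := 𝓡.biUnion Rule.sp

/-! ### Atomic decompositions -/

/-- The predicates occurring in a rule set. -/
def RuleSet.predsF (𝓡 : RuleSet) : Finset ℕ :=
  𝓡.sup fun R => (R.body.image Atom.pred) ∪ (R.head.image Atom.pred)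

/-- A fresh predicate `X_R`, unique for `R` and not occurring in `𝓡`. -/
def freshPred (𝓡 : RuleSet) (R : Rule) : ℕ :=
  (RuleSet.predsF 𝓡).sup id + 1 + Encodable.encode R

/-- The atom `X_R(x, z)` over the fresh predicate, whose arguments are the frontier
variables followed by the existential variables of `R`. -/
def xAtom (𝓡 : RuleSet) (R : Rule) : Atom :=
  ⟨freshPred 𝓡 R,
    ((R.frontier.sort (· ≤ ·)).map Term.var) ++ ((R.exVars.sort (· ≤ ·)).map Term.var)⟩

/-- The one-way atomic decomposition of a rule `R = B → ∃z.H` (relative to `𝓡`):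
the rule `B → ∃z.X_R(x,z)` together with a rule `X_R(x,z) → P(t)` for each head atom. -/
def oneAdRule (𝓡 : RuleSet) (R : Rule) : Finset Rule :=
  insert ⟨R.body, {xAtom 𝓡 R}, R.body_nonempty, Finset.singleton_nonempty _⟩
    (R.head.attach.image fun a =>
      ⟨{xAtom 𝓡 R}, {a.1}, Finset.singleton_nonempty _, Finset.singleton_nonempty _⟩)

/-- The one-way atomic decomposition of a rule set. -/
def oneAd (𝓡 : RuleSet) : RuleSet := 𝓡.biUnion (oneAdRule 𝓡)

/-- The two-way atomic decomposition: `2ad(R) = 1ad(R) ∪ {H[x,z] → X_R(x,z)}`. -/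
def twoAd (𝓡 : RuleSet) : RuleSet :=
  oneAd 𝓡 ∪ 𝓡.image fun R =>
    ⟨R.head, {xAtom 𝓡 R}, R.head_nonempty, Finset.singleton_nonempty _⟩

/-! ### Models, entailment, BDDP -/

/-- `M` is a model of the rule set `𝓡`. -/
def IsModelOfRules (𝓡 : RuleSet) (M : Set Atom) : Prop := ∀ R ∈ 𝓡, SatisfiesRule M R

/-- `M` is a model of the knowledge base `⟨𝓡, F⟩`. -/
def IsModelOfKB (𝓡 : RuleSet) (F : FactBase) (M : Set Atom) : Prop :=
  IsModelOfRules 𝓡 M ∧ ∃ σ : Subst, IsHom σ ↑F M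

/-- `M` is a universal model of `⟨𝓡, F⟩`: a model mapping homomorphically into
every model. -/
def IsUniversalModel (𝓡 : RuleSet) (F : FactBase) (M : Set Atom) : Prop :=
  IsModelOfKB 𝓡 F M ∧ ∀ N : Set Atom, IsModelOfKB 𝓡 F N → ∃ σ : Subst, IsHom σ M N

/-- An atom set entails a Boolean conjunctive query `Q` if `Q` maps
homomorphically into it. -/
def EntailsQ (S : Set Atom) (Q : Finset Atom) : Prop := ∃ σ : Subst, IsHom σ ↑Q S

/-- `⟨𝓡, F⟩ ⊨ Q`: every model of the KB entails `Q`. -/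
def KBEntails (𝓡 : RuleSet) (F : FactBase) (Q : Finset Atom) : Prop :=
  ∀ M : Set Atom, IsModelOfKB 𝓡 F M → EntailsQ M Q

/-- `R(F)`: the minimal atom set including `F` and `out(t)` for every trigger `t`
with rule `R` on `F`. -/
def ruleStep (R : Rule) (S : Set Atom) : Set Atom :=
  S ∪ {a | ∃ t : Trigger, t.rule = R ∧ IsHom t.map ↑R.body S ∧ a ∈ t.out}

/-- `𝓡(F) = ⋃_{R ∈ 𝓡} R(F)` (together with `F`). -/
def setStep (𝓡 : RuleSet) (S : Set Atom) : Set Atom := S ∪ ⋃ R ∈ 𝓡, ruleStep R S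

/-- The breadth-first chase `Ch_i(⟨𝓡, F⟩)`. -/
def ch (𝓡 : RuleSet) (F : FactBase) : ℕ → Set Atom
  | 0 => ↑F
  | i + 1 => setStep 𝓡 (ch 𝓡 F i)

/-- The bounded derivation depth property. -/
def BDDP (𝓡 : RuleSet) : Prop :=
  ∀ Q : Finset Atom, ∃ k : ℕ, ∀ F : FactBase, KBEntails 𝓡 F Q ↔ EntailsQ (ch 𝓡 F k) Q

/-! ### Conservative extensions -/

/-- The restriction of an atom set to the atoms over a given set of predicates. -/
def restrictTo (M : Set Atom) (P : Set ℕ) : Set Atom := {a ∈ M | a.pred ∈ P}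

/-- The terms (domain elements) of an atom set. -/
def termsOf (M : Set Atom) : Set Term := {u | ∃ a ∈ M, u ∈ a.args}

/-- `𝓡'` is a conservative extension of `𝓡`. -/
def ConservativeExt (𝓡 𝓡' : RuleSet) : Prop :=
  (↑(RuleSet.predsF 𝓡) : Set ℕ) ⊆ ↑(RuleSet.predsF 𝓡') ∧
  (∀ M : Set Atom, IsModelOfRules 𝓡' M →
    IsModelOfRules 𝓡 (restrictTo M ↑(RuleSet.predsF 𝓡))) ∧
  (∀ M : Set Atom, IsModelOfRules 𝓡 M →
    ∃ M' : Set Atom, M ⊆ M' ∧ IsModelOfRules 𝓡' M' ∧ termsOf M' = termsOf M ∧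
      restrictTo M' ↑(RuleSet.predsF 𝓡) = restrictTo M ↑(RuleSet.predsF 𝓡))

/-- `𝓡'` is a universal-conservative extension of `𝓡`. -/
def UnivConservativeExt (𝓡 𝓡' : RuleSet) : Prop :=
  (↑(RuleSet.predsF 𝓡) : Set ℕ) ⊆ ↑(RuleSet.predsF 𝓡') ∧
  ∀ F : FactBase, (∀ a ∈ F, a.pred ∈ RuleSet.predsF 𝓡) →
    (∀ M : Set Atom, IsUniversalModel 𝓡' F M →
      IsUniversalModel 𝓡 F (restrictTo M ↑(RuleSet.predsF 𝓡))) ∧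
    (∀ M : Set Atom, IsUniversalModel 𝓡 F M →
      ∃ M' : Set Atom, M ⊆ M' ∧ IsUniversalModel 𝓡' F M' ∧ termsOf M' = termsOf M ∧
        restrictTo M' ↑(RuleSet.predsF 𝓡) = restrictTo M ↑(RuleSet.predsF 𝓡))

def aP (t u : Term) : Atom := ⟨0, [t, u]⟩
def vx : Term := Term.var 0
def vy : Term := Term.var 1
def vz : Term := Term.var 2

/-- `𝓡₀ = {P(x,y) → ∃z.(P(y,z) ∧ P(z,y))}`. -/
def R0set : RuleSet :=
  { ⟨{aP vx vy}, {aP vy vz, aP vz vy},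
      Finset.singleton_nonempty _, Finset.insert_nonempty _ _⟩ }

/-- The rule `P(x,y) → ∃z.(P(y,z) ∧ P(z,y))`. -/
def chainRule : Rule :=
  ⟨{aP vx vy}, {aP vy vz, aP vz vy}, Finset.singleton_nonempty _, Finset.insert_nonempty _ _⟩

theorem R0set_eq : R0set = {chainRule} := rfl

/-- The fresh predicate of the decomposition of `chainRule`. -/
def auxPred : ℕ := freshPred R0set chainRule

/-- An atom over the fresh predicate. -/
def aX (t u : Term) : Atom := ⟨auxPred, [t, u]⟩

theorem auxPred_ne_zero : auxPred ≠ 0 := by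
  unfold auxPred freshPred; omega

theorem vars_binary (p v w : ℕ) : (Atom.mk p [.var v, .var w]).vars = {v, w} := by
  simp [Atom.vars, Term.vars]

theorem chainRule_body_vars : FactBase.vars chainRule.body = {0, 1} := by
  simp [chainRule, FactBase.vars, aP, vx, vy, vars_binary]

theorem chainRule_head_vars : FactBase.vars chainRule.head = {1, 2} := by
  simp [chainRule, FactBase.vars, aP, vz, vy, vars_binary]
  decide

theorem chainRule_exVars : chainRule.exVars = {2} := by
  rw [Rule.exVars, chainRule_body_vars, chainRule_head_vars]; decide

theorem sort_zero_one : ({0, 1} : Finset ℕ).sort (· ≤ ·) = [0, 1] := by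
  rw [Finset.sort_insert _ (by simp) (by simp), Finset.sort_singleton]

theorem xAtom_chainRule : xAtom R0set chainRule = aX vy vz := by
  have h1 : chainRule.frontier = {1} := by
    rw [Rule.frontier, chainRule_body_vars, chainRule_head_vars]; decide
  simp [xAtom, h1, chainRule_exVars, aX, auxPred, vy, vz]

/-- The rule `P(x,y) → ∃z.X(y,z)`. -/
def genRule : Rule :=
  ⟨{aP vx vy}, {aX vy vz}, Finset.singleton_nonempty _, Finset.singleton_nonempty _⟩

/-- The rule `X(y,z) → P(y,z)`. -/
def fwdRule : Rule :=
  ⟨{aX vy vz}, {aP vy vz}, Finset.singleton_nonempty _, Finset.singleton_nonempty _⟩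

/-- The rule `X(y,z) → P(z,y)`. -/
def bwdRule : Rule :=
  ⟨{aX vy vz}, {aP vz vy}, Finset.singleton_nonempty _, Finset.singleton_nonempty _⟩

theorem mem_oneAd_R0set {R : Rule} :
    R ∈ oneAd R0set ↔ R = genRule ∨ R = fwdRule ∨ R = bwdRule := by
  have h : ∀ R S : Rule, R = S ↔ R.body = S.body ∧ R.head = S.head := by
    intro R S; cases R; cases S; simp
  rw [R0set_eq, oneAd, Finset.singleton_biUnion, ← R0set_eq, oneAdRule]
  simp only [xAtom_chainRule, Finset.mem_insert, Finset.mem_image, Finset.mem_attach, true_and,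
    Subtype.exists, h, genRule, fwdRule, bwdRule]
  simp [chainRule, eq_comm, and_or_left]

/-! ### Substitutions and retractions -/

theorem subst_aP (σ : Subst) (t u : Term) :
    (aP t u).subst σ = aP (applyTerm σ t) (applyTerm σ u) := rfl

theorem subst_aX (σ : Subst) (t u : Term) :
    (aX t u).subst σ = aX (applyTerm σ t) (applyTerm σ u) := rfl

theorem aP_ne_aX (t u t' u' : Term) : aP t u ≠ aX t' u' := by
  intro h
  exact auxPred_ne_zero (congrArg Atom.pred h).symm

theorem aP_inj {t u t' u' : Term} : aP t u = aP t' u' ↔ t = t' ∧ u = u' := by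
  simp [aP]

theorem aX_inj {t u t' u' : Term} : aX t u = aX t' u' ↔ t = t' ∧ u = u' := by
  simp [aX]

theorem Atom.mem_vars {a : Atom} {v : ℕ} : v ∈ a.vars ↔ Term.var v ∈ a.args := by
  obtain ⟨p, l⟩ := a
  induction l with
  | nil => simp [Atom.vars]
  | cons t l ih =>
    simp only [Atom.vars, List.foldr_cons, Finset.mem_union, List.mem_cons] at ih ⊢
    rw [ih]
    cases t <;> simp [Term.vars]

theorem mem_setVars {S : Set Atom} {v : ℕ} : v ∈ setVars S ↔ Term.var v ∈ termsOf S := by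
  simp [setVars, termsOf, Atom.mem_vars]

theorem Atom.subst_eq_self {σ : Subst} {a : Atom} (h : ∀ t ∈ a.args, applyTerm σ t = t) :
    a.subst σ = a := by
  obtain ⟨p, l⟩ := a
  simp only [Atom.subst, Atom.mk.injEq, true_and]
  exact (List.map_congr_left h).trans (List.map_id l)

theorem applyTerm_var (t : Term) : applyTerm Term.var t = t := by
  cases t <;> rfl

theorem not_applicable_iff {t : Trigger} {F : FactBase} :
    ¬ Applicable .R t F ↔
      ∃ σ : Subst, (∀ u ∈ termsOf ↑F, applyTerm σ u = u) ∧ IsHom σ ↑t.out ↑F := by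
  constructor
  · intro h
    obtain ⟨σ, hσ, hfix⟩ := not_not.1 h
    refine ⟨σ, fun u hu => ?_, fun a ha => hσ a (by simp [Finset.mem_coe.1 ha])⟩
    cases u with
    | const c => rfl
    | var v =>
      refine hfix v (mem_setVars.2 ?_) (mem_setVars.2 hu)
      obtain ⟨a, ha, hv⟩ := hu
      exact ⟨a, by simp [Finset.mem_coe.1 ha], hv⟩
  · rintro ⟨σ, hfix, hout⟩
    refine not_not.2 ⟨σ, fun a ha => ?_, fun v _ hv => hfix _ (mem_setVars.1 hv)⟩
    rcases Finset.mem_union.1 (Finset.mem_coe.1 ha) with h | h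
    · rw [Atom.subst_eq_self fun u hu => hfix u ⟨a, h, hu⟩]
      exact h
    · exact hout a h

theorem not_applicable_of_subset {t : Trigger} {F : FactBase} (h : t.out ⊆ F) :
    ¬ Applicable .R t F := by
  refine not_applicable_iff.2 ⟨Term.var, fun u _ => applyTerm_var u, fun a ha => ?_⟩
  rw [Atom.subst_eq_self fun u _ => applyTerm_var u]
  exact h ha

/-- The substitution replacing a single variable by a term. -/
def replaceVar (v : ℕ) (u : Term) : Subst := Function.update Term.var v u

theorem applyTerm_replaceVar_self (v : ℕ) (u : Term) :
    applyTerm (replaceVar v u) (Term.var v) = u := by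
  simp [applyTerm, replaceVar]

theorem applyTerm_replaceVar_of_ne {v : ℕ} {u t : Term} (h : t ≠ Term.var v) :
    applyTerm (replaceVar v u) t = t := by
  cases t with
  | const c => rfl
  | var w =>
    have : w ≠ v := fun e => h (e ▸ rfl)
    simp [applyTerm, replaceVar, this]

/-! ### Fresh variables and trigger outputs -/

/-- The fresh variable of a trigger of `R` mapping the two body variables to `c` and `d`. -/
def fresh (R : Rule) (c d : Term) : ℕ := Nat.pair (Encodable.encode (R, [c, d])) 2

theorem fresh_inj {R : Rule} {c d c' d' : Term} (h : fresh R c d = fresh R c' d') :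
    c = c' ∧ d = d' := by
  have h := Encodable.encode_injective (Nat.pair_eq_pair.1 h).1
  simpa using h

theorem encode_lt_encode_fresh (R : Rule) (c d : Term) :
    Encodable.encode c < Encodable.encode (Term.var (fresh R c d)) ∧
      Encodable.encode d < Encodable.encode (Term.var (fresh R c d)) := by
  have h1 : Encodable.encode [c, d] ≤ fresh R c d :=
    (Nat.right_le_pair _ _).trans (Nat.left_le_pair _ 2)
  have h2 : Encodable.encode (Term.var (fresh R c d)) = 2 * fresh R c d + 1 := rfl
  have h3 : Encodable.encode [c, d] = Nat.succ (Nat.pair (Encodable.encode c)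
    (Nat.succ (Nat.pair (Encodable.encode d) (Encodable.encode ([] : List Term))))) := rfl
  have h4 := Nat.left_le_pair (Encodable.encode c)
    (Nat.succ (Nat.pair (Encodable.encode d) (Encodable.encode ([] : List Term))))
  have h5 := Nat.right_le_pair (Encodable.encode c)
    (Nat.succ (Nat.pair (Encodable.encode d) (Encodable.encode ([] : List Term))))
  have h6 := Nat.left_le_pair (Encodable.encode d) (Encodable.encode ([] : List Term))
  omega

theorem Trigger.freshVar_eq {t : Trigger} (h : FactBase.vars t.rule.body = {0, 1}) :
    t.freshVar 2 = fresh t.rule (t.map 0) (t.map 1) := by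
  rw [Trigger.freshVar, h, sort_zero_one]
  rfl

theorem genRule_body_vars : FactBase.vars genRule.body = {0, 1} := chainRule_body_vars

theorem genRule_exVars : genRule.exVars = {2} := by
  have : FactBase.vars genRule.head = {1, 2} := by
    simp [genRule, FactBase.vars, aX, vz, vy, vars_binary]
  rw [Rule.exVars, genRule_body_vars, this]; decide

theorem fwdRule_exVars : fwdRule.exVars = ∅ := by
  simp [fwdRule, Rule.exVars, FactBase.vars, aP, aX, vz, vy, vars_binary]

theorem bwdRule_exVars : bwdRule.exVars = ∅ := by
  simp [bwdRule, Rule.exVars, FactBase.vars, aP, aX, vz, vy, vars_binary]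
  decide

theorem out_chainRule {t : Trigger} (h : t.rule = chainRule) :
    t.out = {aP (t.map 1) (.var (fresh chainRule (t.map 0) (t.map 1))),
      aP (.var (fresh chainRule (t.map 0) (t.map 1))) (t.map 1)} := by
  have hv := Trigger.freshVar_eq (t := t) (by rw [h]; exact chainRule_body_vars)
  rw [h] at hv
  have h1 : t.ext 1 = t.map 1 := by simp [Trigger.ext, h, chainRule_exVars]
  have h2 : t.ext 2 = .var (fresh chainRule (t.map 0) (t.map 1)) := by
    simp [Trigger.ext, h, chainRule_exVars, hv]
  have h3 : t.rule.head = {aP vy vz, aP vz vy} := by rw [h]; rfl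
  simp [Trigger.out, h3, subst_aP, Finset.image_insert, applyTerm, vy, vz, h1, h2]

theorem out_genRule {t : Trigger} (h : t.rule = genRule) :
    t.out = {aX (t.map 1) (.var (fresh genRule (t.map 0) (t.map 1)))} := by
  have hv := Trigger.freshVar_eq (t := t) (by rw [h]; exact genRule_body_vars)
  rw [h] at hv
  have h1 : t.ext 1 = t.map 1 := by simp [Trigger.ext, h, genRule_exVars]
  have h2 : t.ext 2 = .var (fresh genRule (t.map 0) (t.map 1)) := by
    simp [Trigger.ext, h, genRule_exVars, hv]
  have h3 : t.rule.head = {aX vy vz} := by rw [h]; rfl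
  simp [Trigger.out, h3, subst_aX, applyTerm, vy, vz, h1, h2]

theorem out_fwdRule {t : Trigger} (h : t.rule = fwdRule) : t.out = {aP (t.map 1) (t.map 2)} := by
  have h1 : t.ext = t.map := by funext v; simp [Trigger.ext, h, fwdRule_exVars]
  have h3 : t.rule.head = {aP vy vz} := by rw [h]; rfl
  simp [Trigger.out, h3, subst_aP, applyTerm, vy, vz, h1]

theorem out_bwdRule {t : Trigger} (h : t.rule = bwdRule) : t.out = {aP (t.map 2) (t.map 1)} := by
  have h1 : t.ext = t.map := by funext v; simp [Trigger.ext, h, bwdRule_exVars]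
  have h3 : t.rule.head = {aP vz vy} := by rw [h]; rfl
  simp [Trigger.out, h3, subst_aP, applyTerm, vy, vz, h1]

theorem isOn_chainRule {t : Trigger} (h : t.rule = chainRule) {F : FactBase} :
    t.IsOn F ↔ aP (t.map 0) (t.map 1) ∈ F := by
  have h3 : t.rule.body = {aP vx vy} := by rw [h]; rfl
  simp [Trigger.IsOn, IsHom, h3, subst_aP, applyTerm, vx, vy]

theorem isOn_genRule {t : Trigger} (h : t.rule = genRule) {F : FactBase} :
    t.IsOn F ↔ aP (t.map 0) (t.map 1) ∈ F := by
  have h3 : t.rule.body = {aP vx vy} := by rw [h]; rfl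
  simp [Trigger.IsOn, IsHom, h3, subst_aP, applyTerm, vx, vy]

theorem isOn_fwdRule {t : Trigger} (h : t.rule = fwdRule) {F : FactBase} :
    t.IsOn F ↔ aX (t.map 1) (t.map 2) ∈ F := by
  have h3 : t.rule.body = {aX vy vz} := by rw [h]; rfl
  simp [Trigger.IsOn, IsHom, h3, subst_aX, applyTerm, vz, vy]

theorem isOn_bwdRule {t : Trigger} (h : t.rule = bwdRule) {F : FactBase} :
    t.IsOn F ↔ aX (t.map 1) (t.map 2) ∈ F := by
  have h3 : t.rule.body = {aX vy vz} := by rw [h]; rfl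
  simp [Trigger.IsOn, IsHom, h3, subst_aX, applyTerm, vz, vy]

theorem right_mem_termsOf {S : Set Atom} {t u : Term} (h : aP t u ∈ S) : u ∈ termsOf S :=
  ⟨_, h, by simp [aP]⟩

theorem left_mem_termsOf_aX {S : Set Atom} {t u : Term} (h : aX t u ∈ S) : t ∈ termsOf S :=
  ⟨_, h, by simp [aX]⟩

theorem right_mem_termsOf_aX {S : Set Atom} {t u : Term} (h : aX t u ∈ S) : u ∈ termsOf S :=
  ⟨_, h, by simp [aX]⟩

theorem finite_termsOf (F : FactBase) : (termsOf ↑F).Finite := by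
  refine (F.biUnion fun a => a.args.toFinset).finite_toSet.subset ?_
  rintro u ⟨a, ha, hu⟩
  simpa using ⟨a, ha, hu⟩

/-! ### Termination of the original rule set -/

namespace Derivation

variable {𝓡 : RuleSet} {F : FactBase}

theorem fb_mono (D : Derivation 𝓡 F) : Monotone D.fb := by
  refine monotone_nat_of_le_succ fun i => ?_
  by_cases h : (i : ℕ∞) < D.len
  · rw [D.fb_succ i h]
    exact Finset.subset_union_left
  · rw [D.fb_stall i h]

theorem finite_of_isX_R0set (D : Derivation R0set F) (hX : D.IsX .R) : D.Finite := by
  intro hlen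
  have hlt : ∀ i : ℕ, (i : ℕ∞) < D.len := fun i => hlen ▸ ENat.natCast_lt_top i
  have hrule : ∀ i, (D.tr i).rule = chainRule := fun i => by
    simpa [R0set_eq] using D.rule_mem i (hlt i)
  set d : ℕ → Term := fun i => (D.tr i).map 1
  set v : ℕ → ℕ := fun i => fresh chainRule ((D.tr i).map 0) (d i)
  have hout : ∀ i, (D.tr i).out = {aP (d i) (.var (v i)), aP (.var (v i)) (d i)} :=
    fun i => out_chainRule (hrule i)
  have hbody : ∀ i, aP ((D.tr i).map 0) (d i) ∈ D.fb i := fun i =>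
    (isOn_chainRule (hrule i)).1 (D.trig_on i (hlt i))
  have hmem : ∀ i j, i < j → (D.tr i).out ⊆ D.fb j := fun i j hij => by
    refine subset_trans ?_ (D.fb_mono hij)
    rw [D.fb_succ i (hlt i)]
    exact Finset.subset_union_right
  have hvne : ∀ i j, i < j → v i ≠ v j := fun i j hij h => by
    obtain ⟨-, h2⟩ := fresh_inj h
    refine D.trig_new j (hlt j) ?_
    have := hmem i j hij
    rwa [hout, h, h2, ← hout] at this
  have hvinj : Function.Injective v := fun i j h => by
    by_contra hne
    rcases Nat.lt_or_gt_of_ne hne with hij | hij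
    · exact hvne i j hij h
    · exact hvne j i hij h.symm
  have hterms : ∀ i, ∀ u ∈ termsOf ↑(D.fb i), u ∈ termsOf ↑F ∨ ∃ j < i, u = .var (v j) := by
    intro i
    induction i with
    | zero => rw [D.fb_zero]; exact fun u hu => .inl hu
    | succ i ih =>
      rintro u ⟨a, ha, hu⟩
      have lift : u ∈ termsOf ↑(D.fb i) → u ∈ termsOf ↑F ∨ ∃ j < i + 1, u = .var (v j) :=
        fun h => (ih u h).imp_right fun ⟨j, hj, e⟩ => ⟨j, by omega, e⟩
      rw [D.fb_succ i (hlt i), hout] at ha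
      have hu' : a ∈ D.fb i ∨ u = d i ∨ u = .var (v i) := by
        simp only [Finset.coe_union, Set.mem_union, Finset.mem_coe, Finset.mem_insert,
          Finset.mem_singleton] at ha
        rcases ha with ha | rfl | rfl
        · exact .inl ha
        · right; simpa [aP] using hu
        · right; simpa [aP, or_comm] using hu
      rcases hu' with h | rfl | rfl
      · exact lift ⟨a, h, hu⟩
      · exact lift (right_mem_termsOf (hbody i))
      · exact .inr ⟨i, by omega, rfl⟩
  have hsymm : ∀ i, Term.var (v i) ∉ termsOf ↑F → ∀ u, aP (d i) u ∈ D.fb i →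
      aP u (d i) ∉ D.fb i := by
    intro i hi u h1 h2
    have hfresh : Term.var (v i) ∉ termsOf ↑(D.fb i) := fun h => by
      rcases hterms i _ h with h | ⟨j, hj, h⟩
      · exact hi h
      · exact hvne j i hj (Term.var.inj h).symm
    have hfix : ∀ w ∈ termsOf ↑(D.fb i), applyTerm (replaceVar (v i) u) w = w := fun w hw =>
      applyTerm_replaceVar_of_ne fun e => hfresh (e ▸ hw)
    refine not_applicable_iff.2 ⟨_, hfix, ?_⟩ (hX i (hlt i))
    rw [hout]
    intro a ha
    simp only [Finset.coe_insert, Finset.coe_singleton, Set.mem_insert_iff,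
      Set.mem_singleton_iff] at ha
    rcases ha with rfl | rfl <;>
      rw [subst_aP, applyTerm_replaceVar_self, hfix _ (right_mem_termsOf (hbody i))]
    · exact h1
    · exact h2
  have hpair : ∀ i j, i < j → aP (d i) (.var (v i)) ∈ D.fb j ∧ aP (.var (v i)) (d i) ∈ D.fb j := by
    intro i j hij
    have := hmem i j hij
    rw [hout] at this
    exact ⟨this (by simp), this (by simp)⟩
  have hbad : {i | Term.var (v i) ∈ termsOf ↑F}.Finite :=
    (finite_termsOf F).preimage fun i _ j _ h => hvinj (Term.var.inj h)
  have hgood : {i | Term.var (v i) ∉ termsOf ↑F}.Finite := by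
    refine Set.Finite.of_finite_image ((finite_termsOf F).subset ?_) (f := d) ?_
    · rintro _ ⟨i, hi, rfl⟩
      refine (hterms i _ (right_mem_termsOf (hbody i))).resolve_right ?_
      rintro ⟨j, hj, e⟩
      have := hpair j i hj
      rw [← e] at this
      exact hsymm i hi _ this.2 this.1
    · have key : ∀ i j, i < j → Term.var (v j) ∉ termsOf ↑F → d i ≠ d j := fun i j hij hj e => by
        have := hpair i j hij
        rw [e] at this
        exact hsymm j hj _ this.1 this.2
      intro i hi j hj h
      by_contra hne
      rcases Nat.lt_or_gt_of_ne hne with hij | hij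
      · exact key i j hij hj h
      · exact key j i hij hi h.symm
  refine Set.infinite_univ (α := ℕ) ((hbad.union hgood).subset fun i _ => ?_)
  exact em _

end Derivation

/-- The triggers of rules of `𝓡` that are applicable on `F`. -/
def IsActive (𝓡 : RuleSet) (F : FactBase) (t : Trigger) : Prop :=
  t.rule ∈ 𝓡 ∧ t.IsOn F ∧ Applicable .R t F

instance : Nonempty Trigger := ⟨⟨chainRule, Term.var⟩⟩

/-- Some applicable trigger, if there is one. -/
def pickTrigger (𝓡 : RuleSet) (F : FactBase) : Trigger := Classical.epsilon (IsActive 𝓡 F)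

/-- Apply some applicable trigger, if there is one. -/
def greedyStep (𝓡 : RuleSet) (F : FactBase) : FactBase :=
  if ∃ t, IsActive 𝓡 F t then F ∪ (pickTrigger 𝓡 F).out else F

/-- Any restricted chase derivation can be run until it is stuck. -/
theorem exists_fair_derivation_of_finite {𝓡 : RuleSet} {F : FactBase}
    (hfin : ∀ D : Derivation 𝓡 F, D.IsX .R → D.Finite) :
    ∃ D : Derivation 𝓡 F, D.IsX .R ∧ D.Fair .R ∧ D.Finite := by
  set fb : ℕ → FactBase := fun i => (greedyStep 𝓡)^[i] F
  have hsucc : ∀ i, fb (i + 1) = greedyStep 𝓡 (fb i) := fun i =>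
    Function.iterate_succ_apply' _ _ _
  set stuck : ℕ → Prop := fun i => ¬ ∃ t, IsActive 𝓡 (fb i) t
  have hstuck : ∀ i, stuck i → fb (i + 1) = fb i := fun i h => by
    rw [hsucc, greedyStep, if_neg h]
  have hstuck' : ∀ i, stuck i → stuck (i + 1) := fun i h => by
    simpa only [stuck, hstuck i h] using h
  have hstuck_mono : ∀ i j, i ≤ j → stuck i → stuck j := fun i j hij h =>
    Nat.le_induction h (fun k _ => hstuck' k) j hij
  have hactive : ∀ i, ¬ stuck i → IsActive 𝓡 (fb i) (pickTrigger 𝓡 (fb i)) := fun i h =>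
    Classical.epsilon_spec (not_not.1 h)
  set len : ℕ∞ := if h : ∃ i, stuck i then (Nat.find h : ℕ∞) else ⊤ with hlen
  have hlt : ∀ i : ℕ, (i : ℕ∞) < len ↔ ¬ stuck i := by
    intro i
    by_cases h : ∃ i, stuck i
    · rw [hlen, dif_pos h, Nat.cast_lt, Nat.lt_find_iff]
      exact ⟨fun H => H i le_rfl, fun H j hj hs => H (hstuck_mono j i hj hs)⟩
    · rw [hlen, dif_neg h]
      exact ⟨fun _ hs => h ⟨i, hs⟩, fun _ => ENat.natCast_lt_top i⟩
  let D : Derivation 𝓡 F :=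
    { len := len
      fb := fb
      tr := fun i => pickTrigger 𝓡 (fb i)
      fb_zero := rfl
      rule_mem := fun i h => (hactive i ((hlt i).1 h)).1
      trig_on := fun i h => (hactive i ((hlt i).1 h)).2.1
      trig_new := fun i h hsub =>
        not_applicable_of_subset hsub (hactive i ((hlt i).1 h)).2.2
      fb_succ := fun i h => by
        rw [hsucc, greedyStep, if_pos (not_not.1 ((hlt i).1 h))]
      fb_stall := fun i h => hstuck i (not_not.1 (mt (hlt i).2 h)) }
  have hX : D.IsX .R := fun i h => (hactive i ((hlt i).1 h)).2.2
  have hD := hfin D hX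
  obtain ⟨n, hn⟩ := ENat.ne_top_iff_exists.1 hD
  have hn' : stuck n := not_not.1 (mt (hlt n).2 (by rw [show len = n from hn.symm]; simp))
  refine ⟨D, hX, fun i hi t ht hon happ => ?_, hD⟩
  refine ⟨n, ?_, hn.le, fun h => ?_⟩
  · rw [← hn, Nat.cast_le] at hi
    refine lt_of_le_of_ne hi ?_
    rintro rfl
    exact hn' ⟨t, ht, hon, happ⟩
  · exact hn' ⟨t, ht, fun a ha => D.fb_mono (by rwa [← hn, Nat.cast_le] at hi) (hon a ha), h⟩

theorem Derivation.datalogFirst_R0set {F : FactBase} (D : Derivation R0set F) :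
    D.DatalogFirst := by
  intro i _ _ R hR hdl
  have : R = chainRule := by simpa [R0set_eq] using hR
  rw [this, Rule.IsDatalog, chainRule_exVars] at hdl
  simp at hdl

/-! ### Non-termination of the decomposed rule set -/

theorem infinite_of_fair_oneAd {a b : Term} (D : Derivation (oneAd R0set) {aP a b})
    (hfair : D.Fair .R) : ¬ D.Finite := by
  intro hfin
  obtain ⟨n, hn⟩ := ENat.ne_top_iff_exists.1 hfin
  have hstuck : ∀ t : Trigger, t.rule ∈ oneAd R0set → t.IsOn (D.fb n) →
      ¬ Applicable .R t (D.fb n) := fun t ht hon happ => by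
    obtain ⟨j, hj, hjn, -⟩ := hfair n hn.le t ht hon happ
    rw [← hn, Nat.cast_le] at hjn
    omega
  have hrank : ∀ i : ℕ, ∀ t u, aX t u ∈ D.fb i → Encodable.encode t < Encodable.encode u := by
    intro i
    induction i with
    | zero =>
      intro t u h
      rw [D.fb_zero, Finset.mem_singleton] at h
      exact (aP_ne_aX _ _ _ _ h.symm).elim
    | succ i ih =>
      intro t u h
      by_cases hi : (i : ℕ∞) < D.len
      · rw [D.fb_succ i hi, Finset.mem_union] at h
        rcases h with h | h
        · exact ih t u h
        rcases mem_oneAd_R0set.1 (D.rule_mem i hi) with hr | hr | hr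
        · rw [out_genRule hr, Finset.mem_singleton, aX_inj] at h
          rw [h.1, h.2]
          exact (encode_lt_encode_fresh _ _ _).2
        · rw [out_fwdRule hr, Finset.mem_singleton] at h
          exact (aP_ne_aX _ _ _ _ h.symm).elim
        · rw [out_bwdRule hr, Finset.mem_singleton] at h
          exact (aP_ne_aX _ _ _ _ h.symm).elim
      · rw [D.fb_stall i hi] at h
        exact ih t u h
  have hgen : ∀ c d, aP c d ∈ D.fb n → ∃ e, aX d e ∈ D.fb n := by
    intro c d h
    let t : Trigger := ⟨genRule, fun v => if v = 0 then c else d⟩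
    obtain ⟨σ, hfix, hσ⟩ := not_applicable_iff.1
      (hstuck t (mem_oneAd_R0set.2 (.inl rfl)) ((isOn_genRule rfl).2 h))
    rw [out_genRule rfl] at hσ
    have := hσ _ (Finset.mem_coe.2 (Finset.mem_singleton_self _))
    rw [subst_aX, show applyTerm σ (t.map 1) = d from hfix d (right_mem_termsOf h)] at this
    exact ⟨_, this⟩
  have hfwd : ∀ c d, aX c d ∈ D.fb n → aP c d ∈ D.fb n := by
    intro c d h
    let t : Trigger := ⟨fwdRule, fun v => if v = 1 then c else d⟩
    obtain ⟨σ, hfix, hσ⟩ := not_applicable_iff.1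
      (hstuck t (mem_oneAd_R0set.2 (.inr (.inl rfl))) ((isOn_fwdRule rfl).2 h))
    rw [out_fwdRule rfl] at hσ
    have := hσ _ (Finset.mem_coe.2 (Finset.mem_singleton_self _))
    rwa [subst_aP, show applyTerm σ (t.map 1) = c from hfix c (left_mem_termsOf_aX h),
      show applyTerm σ (t.map 2) = d from hfix d (right_mem_termsOf_aX h)] at this
  have hne : {u | ∃ t, aX t u ∈ D.fb n}.Nonempty := by
    obtain ⟨e, he⟩ := hgen a b (D.fb_mono (Nat.zero_le n) (by simp [D.fb_zero]))
    exact ⟨e, b, he⟩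
  have hfinite : {u | ∃ t, aX t u ∈ D.fb n}.Finite :=
    (finite_termsOf (D.fb n)).subset fun u ⟨t, ht⟩ => right_mem_termsOf_aX ht
  obtain ⟨u, ⟨t, ht⟩, hmax⟩ := Set.exists_max_image _ Encodable.encode hfinite hne
  obtain ⟨e, he⟩ := hgen t u (hfwd t u ht)
  exact absurd (hrank n u e he) (not_lt.2 (hmax e ⟨u, he⟩))

/-- The terms of the infinite chase of `{P(a, b)}`, in order of creation. -/
def chainTerm : ℕ → Term
  | 0 => .const 0
  | 1 => .const 1
  | n + 2 => .var (fresh genRule (chainTerm n) (chainTerm (n + 1)))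

theorem chainTerm_injective : Function.Injective chainTerm := by
  have : StrictMono fun n => Encodable.encode (chainTerm n) := by
    refine strictMono_nat_of_lt_succ fun n => ?_
    cases n with
    | zero => exact Nat.zero_lt_succ 1
    | succ n => exact (encode_lt_encode_fresh _ _ _).2
  exact fun m n h => this.injective (congrArg Encodable.encode h)

theorem exists_of_chainTerm_eq_var {c d : Term} {l : ℕ}
    (h : chainTerm l = .var (fresh genRule c d)) :
    ∃ m, l = m + 2 ∧ c = chainTerm m ∧ d = chainTerm (m + 1) := by
  match l, h with
  | m + 2, h => exact ⟨m, rfl, fresh_inj (Term.var.inj h).symm⟩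

/-- The rule used at the steps congruent to a given number modulo three. -/
def chainRuleAt : ℕ → Rule
  | 0 => genRule
  | 1 => fwdRule
  | _ => bwdRule

/-- The atom produced at step `3 * k + r` of the infinite chase. -/
def chainAtom (k : ℕ) : ℕ → Atom
  | 0 => aX (chainTerm (k + 1)) (chainTerm (k + 2))
  | 1 => aP (chainTerm (k + 1)) (chainTerm (k + 2))
  | _ => aP (chainTerm (k + 2)) (chainTerm (k + 1))

/-- The trigger applied at step `i` of the infinite chase. -/
def chainTrigger (i : ℕ) : Trigger := ⟨chainRuleAt (i % 3), fun n => chainTerm (i / 3 + n)⟩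

/-- The factbase after `i` steps of the infinite chase. -/
def chainBase (i : ℕ) : FactBase :=
  insert (aP (chainTerm 0) (chainTerm 1))
    ((Finset.range i).image fun j => chainAtom (j / 3) (j % 3))

theorem mod_three_cases (i : ℕ) : i % 3 = 0 ∨ i % 3 = 1 ∨ i % 3 = 2 := by omega

theorem out_chainTrigger (i : ℕ) : (chainTrigger i).out = {chainAtom (i / 3) (i % 3)} := by
  rcases mod_three_cases i with h | h | h
  · rw [out_genRule (by simp [chainTrigger, h, chainRuleAt])]
    simp [chainTrigger, h, chainAtom, chainTerm]
  · rw [out_fwdRule (by simp [chainTrigger, h, chainRuleAt])]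
    simp [chainTrigger, h, chainAtom]
  · rw [out_bwdRule (by simp [chainTrigger, h, chainRuleAt])]
    simp [chainTrigger, h, chainAtom]

theorem chainAtom_mem_chainBase {i k r : ℕ} (hr : r < 3) (h : 3 * k + r < i) :
    chainAtom k r ∈ chainBase i := by
  refine Finset.mem_insert_of_mem (Finset.mem_image.2 ⟨3 * k + r, Finset.mem_range.2 h, ?_⟩)
  rw [show (3 * k + r) / 3 = k by omega, show (3 * k + r) % 3 = r by omega]

theorem mem_chainBase {i : ℕ} {a : Atom} :
    a ∈ chainBase i ↔ a = aP (chainTerm 0) (chainTerm 1) ∨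
      ∃ k r, r < 3 ∧ 3 * k + r < i ∧ a = chainAtom k r := by
  refine ⟨fun h => ?_, ?_⟩
  · refine (Finset.mem_insert.1 h).imp_right fun h => ?_
    obtain ⟨j, hj, rfl⟩ := Finset.mem_image.1 h
    exact ⟨j / 3, j % 3, Nat.mod_lt _ (by omega), by have := Finset.mem_range.1 hj; omega, rfl⟩
  · rintro (rfl | ⟨k, r, hr, h, rfl⟩)
    · exact Finset.mem_insert_self _ _
    · exact chainAtom_mem_chainBase hr h

theorem aX_mem_chainBase {i : ℕ} {t u : Term} :
    aX t u ∈ chainBase i ↔ ∃ k, 3 * k < i ∧ t = chainTerm (k + 1) ∧ u = chainTerm (k + 2) := by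
  rw [mem_chainBase]
  refine ⟨?_, fun ⟨k, hk, ht, hu⟩ => .inr ⟨k, 0, by omega, hk, by rw [ht, hu]; rfl⟩⟩
  rintro (h | ⟨k, r, hr, hk, h⟩)
  · exact (aP_ne_aX _ _ _ _ h.symm).elim
  · interval_cases r
    · exact ⟨k, hk, aX_inj.1 h⟩
    · exact (aP_ne_aX _ _ _ _ h.symm).elim
    · exact (aP_ne_aX _ _ _ _ h.symm).elim

theorem aP_mem_chainBase {i : ℕ} {t u : Term} :
    aP t u ∈ chainBase i ↔ (t = chainTerm 0 ∧ u = chainTerm 1) ∨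
      ∃ k, (3 * k + 1 < i ∧ t = chainTerm (k + 1) ∧ u = chainTerm (k + 2)) ∨
        (3 * k + 2 < i ∧ t = chainTerm (k + 2) ∧ u = chainTerm (k + 1)) := by
  rw [mem_chainBase, aP_inj]
  refine or_congr_right ⟨?_, ?_⟩
  · rintro ⟨k, r, hr, hk, h⟩
    interval_cases r
    · exact (aP_ne_aX _ _ _ _ h).elim
    · exact ⟨k, .inl ⟨hk, aP_inj.1 h⟩⟩
    · exact ⟨k, .inr ⟨hk, aP_inj.1 h⟩⟩
  · rintro ⟨k, ⟨hk, rfl, rfl⟩ | ⟨hk, rfl, rfl⟩⟩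
    · exact ⟨k, 1, by omega, hk, rfl⟩
    · exact ⟨k, 2, by omega, hk, rfl⟩

theorem exists_chainTerm_of_mem_termsOf {i : ℕ} {t : Term} (h : t ∈ termsOf ↑(chainBase i)) :
    ∃ l, t = chainTerm l := by
  obtain ⟨a, ha, ht⟩ := h
  rcases mem_chainBase.1 (Finset.mem_coe.1 ha) with rfl | ⟨k, r, hr, -, rfl⟩
  · have : t = chainTerm 0 ∨ t = chainTerm 1 := by simpa [aP] using ht
    exact this.elim (⟨_, ·⟩) (⟨_, ·⟩)
  · have : t = chainTerm (k + 1) ∨ t = chainTerm (k + 2) := by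
      interval_cases r
      · simpa [chainAtom, aX] using ht
      · simpa [chainAtom, aP] using ht
      · simpa [chainAtom, aP, or_comm] using ht
    exact this.elim (⟨_, ·⟩) (⟨_, ·⟩)

theorem isOn_chainTrigger (i : ℕ) : (chainTrigger i).IsOn (chainBase i) := by
  have hX : 0 < i % 3 →
      aX ((chainTrigger i).map 1) ((chainTrigger i).map 2) ∈ chainBase i := fun h =>
    aX_mem_chainBase.2 ⟨i / 3, by omega, rfl, rfl⟩
  rcases mod_three_cases i with h | h | h
  · rw [isOn_genRule (by simp [chainTrigger, h, chainRuleAt]), aP_mem_chainBase]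
    by_cases hi : i = 0
    · subst hi; exact .inl ⟨rfl, rfl⟩
    · refine .inr ⟨i / 3 - 1, .inl ⟨by omega, ?_, ?_⟩⟩ <;>
        exact congrArg chainTerm (by omega)
  · rw [isOn_fwdRule (by simp [chainTrigger, h, chainRuleAt])]
    exact hX (by omega)
  · rw [isOn_bwdRule (by simp [chainTrigger, h, chainRuleAt])]
    exact hX (by omega)

theorem applicable_chainTrigger (i : ℕ) : Applicable .R (chainTrigger i) (chainBase i) := by
  by_contra happ
  obtain ⟨σ, hfix, hσ⟩ := not_applicable_iff.1 happ
  rw [out_chainTrigger] at hσ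
  have hσ := hσ _ (Finset.mem_coe.2 (Finset.mem_singleton_self _))
  have hon := isOn_chainTrigger i
  have hX : 0 < i % 3 →
      aX (chainTerm (i / 3 + 1)) (chainTerm (i / 3 + 2)) ∈ chainBase i := fun h =>
    aX_mem_chainBase.2 ⟨i / 3, by omega, rfl, rfl⟩
  rcases mod_three_cases i with h | h | h
  · rw [isOn_genRule (by simp [chainTrigger, h, chainRuleAt])] at hon
    replace hon : aP (chainTerm (i / 3)) (chainTerm (i / 3 + 1)) ∈ chainBase i := hon
    rw [h, chainAtom, subst_aX, hfix _ (right_mem_termsOf hon)] at hσ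
    obtain ⟨k, hk, e, -⟩ := aX_mem_chainBase.1 (Finset.mem_coe.1 hσ)
    have := chainTerm_injective e
    omega
  · have hX := hX (by omega)
    rw [h, chainAtom, subst_aP, hfix _ (left_mem_termsOf_aX hX),
      hfix _ (right_mem_termsOf_aX hX)] at hσ
    rcases aP_mem_chainBase.1 (Finset.mem_coe.1 hσ) with ⟨e, -⟩ | ⟨k, ⟨hk, e, -⟩ | ⟨hk, e, e'⟩⟩
    · have := chainTerm_injective e; omega
    · have := chainTerm_injective e; omega
    · have := chainTerm_injective e; have := chainTerm_injective e'; omega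
  · have hX := hX (by omega)
    rw [h, chainAtom.eq_3 _ _ (by simp) (by simp), subst_aP, hfix _ (left_mem_termsOf_aX hX),
      hfix _ (right_mem_termsOf_aX hX)] at hσ
    rcases aP_mem_chainBase.1 (Finset.mem_coe.1 hσ) with ⟨e, -⟩ | ⟨k, ⟨hk, e, e'⟩ | ⟨hk, e, -⟩⟩
    · have := chainTerm_injective e; omega
    · have := chainTerm_injective e; have := chainTerm_injective e'; omega
    · have := chainTerm_injective e; omega

/-- The infinite Datalog-first restricted chase of `{P(a, b)}`. -/
def chainDerivation : Derivation (oneAd R0set) {aP (chainTerm 0) (chainTerm 1)} where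
  len := ⊤
  fb := chainBase
  tr := chainTrigger
  fb_zero := rfl
  rule_mem i _ := mem_oneAd_R0set.2 <| by
    rcases mod_three_cases i with h | h | h <;> simp [chainTrigger, h, chainRuleAt]
  trig_on i _ := isOn_chainTrigger i
  trig_new i _ h := not_applicable_of_subset h (applicable_chainTrigger i)
  fb_succ i _ := by
    rw [out_chainTrigger, chainBase, chainBase, Finset.range_add_one, Finset.image_insert,
      Finset.union_comm, Finset.singleton_union, Finset.insert_comm]
  fb_stall i h := (h (ENat.natCast_lt_top i)).elim

theorem isX_chainDerivation : chainDerivation.IsX .R := fun i _ => applicable_chainTrigger i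

theorem datalogFirst_chainDerivation : chainDerivation.DatalogFirst := by
  intro i _ hnd R hR hdl
  have hi : i % 3 = 0 := by
    rcases mod_three_cases i with h | h | h
    · exact h
    · exact absurd (show (chainTrigger i).rule.IsDatalog by
        simp [chainTrigger, h, chainRuleAt, Rule.IsDatalog, fwdRule_exVars]) hnd
    · exact absurd (show (chainTrigger i).rule.IsDatalog by
        simp [chainTrigger, h, chainRuleAt, Rule.IsDatalog, bwdRule_exVars]) hnd
  rintro σ hσ
  refine ⟨σ, fun _ _ => rfl, ?_⟩
  show IsHom σ ↑R.head ↑(chainBase i)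
  replace hσ : IsHom σ ↑R.body ↑(chainBase i) := hσ
  rcases mem_oneAd_R0set.1 hR with rfl | rfl | rfl
  · simp [Rule.IsDatalog, genRule_exVars] at hdl
  · intro a ha
    obtain rfl : a = aP vy vz := Finset.mem_singleton.1 (Finset.mem_coe.1 ha)
    obtain ⟨k, hk, e, e'⟩ :=
      aX_mem_chainBase.1 (Finset.mem_coe.1 (hσ (aX vy vz) (by simp [fwdRule])))
    exact aP_mem_chainBase.2 (.inr ⟨k, .inl ⟨by omega, e, e'⟩⟩)
  · intro a ha
    obtain rfl : a = aP vz vy := Finset.mem_singleton.1 (Finset.mem_coe.1 ha)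
    obtain ⟨k, hk, e, e'⟩ :=
      aX_mem_chainBase.1 (Finset.mem_coe.1 (hσ (aX vy vz) (by simp [bwdRule])))
    exact aP_mem_chainBase.2 (.inr ⟨k, .inr ⟨by omega, e', e⟩⟩)

theorem fair_chainDerivation : chainDerivation.Fair .R := by
  intro i _ t ht hon _
  replace hon : t.IsOn (chainBase i) := hon
  suffices h : ∃ j, i < j ∧ ¬ Applicable .R t (chainBase j) by
    obtain ⟨j, hij, hj⟩ := h
    exact ⟨j, hij, le_top, hj⟩
  rcases mem_oneAd_R0set.1 ht with hr | hr | hr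
  · rw [isOn_genRule hr] at hon
    obtain ⟨m, hm⟩ : ∃ m, t.map 1 = chainTerm (m + 1) := by
      rcases aP_mem_chainBase.1 hon with ⟨-, e⟩ | ⟨k, ⟨-, -, e⟩ | ⟨-, -, e⟩⟩
      exacts [⟨_, e⟩, ⟨_, e⟩, ⟨_, e⟩]
    refine ⟨i + 3 * m + 1, by omega, ?_⟩
    have hmem : aX (t.map 1) (chainTerm (m + 2)) ∈ chainBase (i + 3 * m + 1) :=
      aX_mem_chainBase.2 ⟨m, by omega, hm, rfl⟩
    set v := fresh genRule (t.map 0) (t.map 1)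
    have hout := out_genRule hr
    by_cases hv : Term.var v ∈ termsOf ↑(chainBase (i + 3 * m + 1))
    · obtain ⟨l, hl⟩ := exists_chainTerm_of_mem_termsOf hv
      obtain ⟨m', rfl, -, e⟩ := exists_of_chainTerm_eq_var hl.symm
      have : m = m' := by simpa using chainTerm_injective (hm.symm.trans e)
      refine not_applicable_of_subset ?_
      rw [hout, Finset.singleton_subset_iff]
      rwa [show chainTerm (m + 2) = Term.var v by rw [this, hl]] at hmem
    · have hfix : ∀ w ∈ termsOf ↑(chainBase (i + 3 * m + 1)),
          applyTerm (replaceVar v (chainTerm (m + 2))) w = w := fun w hw =>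
        applyTerm_replaceVar_of_ne fun e => hv (e ▸ hw)
      refine not_applicable_iff.2 ⟨_, hfix, ?_⟩
      rw [hout]
      rintro a ha
      rw [Finset.mem_singleton.1 (Finset.mem_coe.1 ha), subst_aX, applyTerm_replaceVar_self,
        hfix _ (left_mem_termsOf_aX hmem)]
      exact hmem
  · rw [isOn_fwdRule hr] at hon
    obtain ⟨k, hk, e, e'⟩ := aX_mem_chainBase.1 hon
    refine ⟨i + 3, by omega, not_applicable_of_subset ?_⟩
    rw [out_fwdRule hr, Finset.singleton_subset_iff]
    exact aP_mem_chainBase.2 (.inr ⟨k, .inl ⟨by omega, e, e'⟩⟩)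
  · rw [isOn_bwdRule hr] at hon
    obtain ⟨k, hk, e, e'⟩ := aX_mem_chainBase.1 hon
    refine ⟨i + 3, by omega, not_applicable_of_subset ?_⟩
    rw [out_bwdRule hr, Finset.singleton_subset_iff]
    exact aP_mem_chainBase.2 (.inr ⟨k, .inr ⟨by omega, e', e⟩⟩)

theorem R0set_terminates :
    CTall .R R0set ∧ CTallDF .R R0set ∧ CTexDF .R R0set ∧ CTex .R R0set := by
  have hex : CTex .R R0set := fun _ =>
    exists_fair_derivation_of_finite fun D hX => D.finite_of_isX_R0set hX
  refine ⟨fun _ D hX _ => D.finite_of_isX_R0set hX, fun _ D hX _ _ => D.finite_of_isX_R0set hX,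
    fun F => ?_, hex⟩
  obtain ⟨D, hX, hfair, hfin⟩ := hex F
  exact ⟨D, hX, D.datalogFirst_R0set, hfair, hfin⟩

theorem oneAd_R0set_not_terminates :
    ¬ CTall .R (oneAd R0set) ∧ ¬ CTallDF .R (oneAd R0set) ∧
      ¬ CTexDF .R (oneAd R0set) ∧ ¬ CTex .R (oneAd R0set) := by
  refine ⟨fun h => ?_, fun h => ?_, fun h => ?_, fun h => ?_⟩
  · exact h _ chainDerivation isX_chainDerivation fair_chainDerivation rfl
  · exact h _ chainDerivation isX_chainDerivation datalogFirst_chainDerivation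
      fair_chainDerivation rfl
  · obtain ⟨D, -, -, hfair, hfin⟩ := h {aP (.const 0) (.const 1)}
    exact infinite_of_fair_oneAd D hfair hfin
  · obtain ⟨D, -, hfair, hfin⟩ := h {aP (.const 0) (.const 1)}
    exact infinite_of_fair_oneAd D hfair hfin

/-- The one-way atomic decomposition does not preserve termination
nor sometimes-termination of the (Datalog-first) restricted chase: there is a rule
set in all four classes `CT_R^∀`, `CT_{df-R}^∀`, `CT_{df-R}^∃`, `CT_R^∃` whose
one-way atomic decomposition is in none of them; in particular `𝓡₀` is such. -/
theorem statement8 :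
    (∃ 𝓡 : RuleSet,
      (CTall Variant.R 𝓡 ∧ CTallDF Variant.R 𝓡 ∧ CTexDF Variant.R 𝓡 ∧ CTex Variant.R 𝓡) ∧
      (¬ CTall Variant.R (oneAd 𝓡) ∧ ¬ CTallDF Variant.R (oneAd 𝓡) ∧
        ¬ CTexDF Variant.R (oneAd 𝓡) ∧ ¬ CTex Variant.R (oneAd 𝓡))) ∧
    ((CTall Variant.R R0set ∧ CTallDF Variant.R R0set ∧ CTexDF Variant.R R0set ∧
        CTex Variant.R R0set) ∧
      (¬ CTall Variant.R (oneAd R0set) ∧ ¬ CTallDF Variant.R (oneAd R0set) ∧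
        ¬ CTexDF Variant.R (oneAd R0set) ∧ ¬ CTex Variant.R (oneAd R0set))) := by
  exact ⟨⟨R0set, R0set_terminates, oneAd_R0set_not_terminates⟩,
    R0set_terminates, oneAd_R0set_not_terminates⟩

end
end ExRules
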